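/- Let A be a commutative ring such that its total quotient ring Q(A) is semisimple, and let M be a finitely presented A-module such that, with S the complement of the union of height-one primes in the support of the torsion submodule M_tor, the localisation S^{-1}A is a finite product of Prüfer domains. Then there exists a pseudo-isomorphism of A-modules M → M_tor ⊕ M/M_tor. -/

import Mathlib

universe u

/-- A module is pseudo-null if its localisation at every prime of height at most one
vanishes. -/
def IsPseudoNull (A : Type*) [CommRing A] (X : Type*) [AddCommGroup X] [Module A X] :
    Prop :=
  ∀ q : PrimeSpectrum A, Order.height q ≤ 1 →
    Subsingleton (LocalizedModule q.asIdeal.primeCompl X)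

/-- A Prüfer (semi-hereditary) domain: a domain over which finitely generated
torsion-free modules are projective. -/
def IsPruferDomain (B : Type u) [CommRing B] : Prop :=
  IsDomain B ∧
    ∀ (N : Type u) [AddCommGroup N] [Module B N], Module.Finite B N →
      Submodule.torsion B N = ⊥ → Module.Projective B N

open TensorProduct in
/-- Finitely generated torsion-free modules over finite products of Prüfer domains are
projective. -/
theorem projective_of_prod {R : Type u} [CommRing R] {n : ℕ} (B : Fin n → Type u)
    [∀ i, CommRing (B i)] (hB : ∀ i, IsPruferDomain (B i)) (e : R ≃+* ((i : Fin n) → B i))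
    (N : Type u) [AddCommGroup N] [Module R N] [Module.Finite R N]
    (hN : ∀ c ∈ nonZeroDivisors R, ∀ x : N, c • x = 0 → x = 0) : Module.Projective R N := by
  classical
  letI alg : ∀ i, Algebra R (B i) := fun i => ((Pi.evalRingHom B i).comp e.toRingHom).toAlgebra
  have halg : ∀ i (r : R), algebraMap R (B i) r = e r i := fun i r => rfl
  -- the (non-unital) inclusions of the factors
  let ι : ∀ i, B i →ₗ[R] R := fun i =>
    { toFun := fun b => e.symm (Pi.single i b)
      map_add' := fun x y => by rw [Pi.single_add, map_add]
      map_smul' := fun r x => by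
        apply e.injective
        simp only [Algebra.smul_def, halg, RingHom.id_apply, smul_eq_mul, map_mul,
          RingEquiv.apply_symm_apply]
        ext k
        by_cases h : k = i
        · subst h; simp
        · simp [h] }
  have hι : ∀ i b, e (ι i b) = Pi.single i b := fun i b => e.apply_symm_apply _
  have hsum : ∑ i, ι i 1 = 1 := by
    apply e.injective
    rw [map_sum]
    simp only [hι, map_one]
    exact Finset.univ_sum_single (1 : ∀ i, B i)
  have hprojB : ∀ i, Module.Projective R (B i) := fun i => by
    refine Module.Projective.of_split (ι i) (Algebra.linearMap R (B i)) ?_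
    ext
    simp [halg, hι]
  let j : ∀ i, (B i ⊗[R] N) →ₗ[R] N := fun i =>
    (TensorProduct.lid R N).toLinearMap ∘ₗ (LinearMap.rTensor N (ι i))
  have hj : ∀ i b x, j i (b ⊗ₜ x) = ι i b • x := fun i b x => by simp [j]
  have hjinj : ∀ i z, (1 : B i) ⊗ₜ[R] (j i z) = z := fun i z => by
    induction z with
    | zero => simp
    | add x y hx hy => rw [map_add, tmul_add, hx, hy]
    | tmul b x =>
      rw [hj, tmul_smul, smul_tmul', Algebra.smul_def, halg, hι]
      simp
  have hjmul : ∀ i (b : B i) z, j i (b • z) = ι i b • j i z := fun i b z => by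
    induction z with
    | zero => simp
    | add x y hx hy => rw [smul_add, map_add, hx, hy, map_add, smul_add]
    | tmul c x =>
      rw [smul_tmul', hj, hj, smul_smul]
      congr 1
      apply e.injective
      rw [map_mul, hι, hι, hι, ← Pi.single_mul, smul_eq_mul]
  have hproj : ∀ i, Module.Projective R (B i ⊗[R] N) := fun i => by
    obtain ⟨hdom, hP⟩ := hB i
    have hX : Module.Projective (B i) (B i ⊗[R] N) := by
      refine hP _ inferInstance ?_
      rw [eq_bot_iff]
      rintro z ⟨⟨b, hb⟩, hz⟩
      change b • z = 0 at hz
      rw [Submodule.mem_bot]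
      have hc : ι i b + (1 - ι i 1) ∈ nonZeroDivisors R := by
        rw [mem_nonZeroDivisors_iff_right]
        intro x hx
        apply e.injective
        have hx' := congrArg e hx
        rw [map_mul, map_add, map_sub, hι, hι, map_one, map_zero] at hx'
        rw [map_zero]
        ext k
        have hk := congrFun hx' k
        by_cases h : k = i
        · subst h
          have : e x k * b = 0 := by simpa using hk
          exact (mul_eq_zero.mp this).resolve_right (nonZeroDivisors.ne_zero hb)
        · simpa [h] using hk
      have h0 := hN _ hc (j i z) (by
        rw [add_smul, sub_smul, one_smul, ← hjmul, ← hjmul, hz, one_smul, sub_self, map_zero,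
          add_zero])
      rw [← hjinj i z, h0, tmul_zero]
    obtain ⟨s, hs⟩ := hX.out
    have : Module.Projective R ((B i ⊗[R] N) →₀ B i) :=
      Module.Projective.of_equiv' (finsuppLequivDFinsupp R).symm
    refine Module.Projective.of_split (s.restrictScalars R)
      ((Finsupp.linearCombination (B i) id).restrictScalars R) ?_
    exact LinearMap.ext fun x => hs x
  have : Module.Projective R (∀ i, (B i ⊗[R] N)) :=
    Module.Projective.of_equiv' (DFinsupp.linearEquivFunOnFintype (R := R))
  refine Module.Projective.of_split
    (LinearMap.pi fun i => TensorProduct.mk R (B i) N 1)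
    (∑ i, j i ∘ₗ LinearMap.proj i) ?_
  ext x
  simp [hj, ← Finset.sum_smul, hsum]

/-- Commutative semisimple rings are von Neumann regular. -/
theorem exists_regular {Q : Type*} [CommRing Q] [IsSemisimpleRing Q] (a : Q) :
    ∃ c, a * c * a = a := by
  obtain ⟨J, hJ⟩ := exists_isCompl (Ideal.span {a})
  have h1 : (1 : Q) ∈ Ideal.span {a} ⊔ J := by rw [hJ.sup_eq_top]; trivial
  obtain ⟨x, hx, y, hy, hxy⟩ := Submodule.mem_sup.mp h1
  obtain ⟨c, rfl⟩ := Ideal.mem_span_singleton'.mp hx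
  refine ⟨c, ?_⟩
  have h0 : a * y ∈ Ideal.span {a} ⊓ J :=
    ⟨Ideal.mul_mem_right _ _ (Ideal.mem_span_singleton_self a), J.mul_mem_left _ hy⟩
  rw [hJ.inf_eq_bot] at h0
  have h0 : a * y = 0 := h0
  linear_combination a * hxy - h0

theorem exists_regular' {A : Type*} [CommRing A] [IsSemisimpleRing (FractionRing A)] (a : A) :
    ∃ d, ∃ r ∈ nonZeroDivisors A, a * (a * d) = a * r := by
  obtain ⟨c, hc⟩ := exists_regular (algebraMap A (FractionRing A) a)
  obtain ⟨⟨d, r⟩, hd⟩ := IsLocalization.surj (nonZeroDivisors A) c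
  refine ⟨d, r, r.2, ?_⟩
  apply IsFractionRing.injective A (FractionRing A)
  simp only [map_mul]
  simp only at hd
  rw [← hd]
  linear_combination (algebraMap A (FractionRing A) r) * hc

theorem localized_torsionFree {A : Type u} [CommRing A] [IsSemisimpleRing (FractionRing A)]
    (M : Type u) [AddCommGroup M] [Module A M] (S : Submonoid A)
    (c : Localization S) (hc : c ∈ nonZeroDivisors (Localization S))
    (x : LocalizedModule S (M ⧸ Submodule.torsion A M)) (hx : c • x = 0) : x = 0 := by
  induction x using LocalizedModule.induction_on with
  | h m s =>
  obtain ⟨⟨a, t⟩, rfl⟩ := IsLocalization.mk'_surjective S c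
  simp only at hx hc
  rw [← Localization.mk_eq_mk', LocalizedModule.mk_smul_mk] at hx
  rw [← LocalizedModule.zero_mk 1, LocalizedModule.mk_eq] at hx
  obtain ⟨u, hu⟩ := hx
  simp only [one_smul, smul_zero] at hu
  have ha : algebraMap A (Localization S) a ∈ nonZeroDivisors (Localization S) := by
    rw [← IsLocalization.mk'_spec (Localization S) a t]
    exact mul_mem hc (IsLocalization.map_units _ t).mem_nonZeroDivisors
  obtain ⟨d, r, hr, hdr⟩ := exists_regular' a
  have h1 : algebraMap A (Localization S) (a * d) = algebraMap A (Localization S) r := by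
    have := congrArg (algebraMap A (Localization S)) hdr
    rw [map_mul, map_mul _ a r] at this
    exact (mul_cancel_left_mem_nonZeroDivisors ha).mp this
  obtain ⟨v, hv⟩ := (IsLocalization.eq_iff_exists S (Localization S)).mp h1
  obtain ⟨m, rfl⟩ := Submodule.Quotient.mk_surjective _ m
  rw [← LocalizedModule.zero_mk 1, LocalizedModule.mk_eq]
  refine ⟨u * v, ?_⟩
  simp only [one_smul, smul_zero]
  rw [Submonoid.smul_def] at hu ⊢
  rw [← Submodule.Quotient.mk_smul, ← Submodule.Quotient.mk_smul,
    Submodule.Quotient.mk_eq_zero] at hu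
  rw [← Submodule.Quotient.mk_smul, Submodule.Quotient.mk_eq_zero]
  obtain ⟨w, hw⟩ := hu
  refine ⟨w * ⟨r, hr⟩, ?_⟩
  rw [Submonoid.smul_def] at hw ⊢
  have : ((w * ⟨r, hr⟩ : nonZeroDivisors A) : A) • ((u * v : S) : A) • m
      = (v * d : A) • ((w : A) • (u : A) • a • m) := by
    simp only [smul_smul, Submonoid.coe_mul]
    congr 1
    linear_combination (- (w : A) * u) * hv
  rw [this, hw, smul_zero]

theorem exists_almost_retraction {A : Type u} [CommRing A] [IsSemisimpleRing (FractionRing A)]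
    (M : Type u) [AddCommGroup M] [Module A M] [Module.FinitePresentation A M]
    (S : Submonoid A)
    (hproj : Module.Projective (Localization S)
      (LocalizedModule S (M ⧸ Submodule.torsion A M))) :
    ∃ (f : M →ₗ[A] Submodule.torsion A M) (s : S), ∀ t : Submodule.torsion A M,
      ∃ u : S, u • f t = u • s • t := by
  set T := Submodule.torsion A M
  have hex : Function.Exact (LocalizedModule.map S T.subtype) (LocalizedModule.map S T.mkQ) :=
    LocalizedModule.map_exact S T.subtype T.mkQ (LinearMap.exact_subtype_mkQ T)
  have hinj : Function.Injective (LocalizedModule.map S T.subtype) :=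
    IsLocalizedModule.map_injective S _ _ _ T.injective_subtype
  have hsurj : Function.Surjective (LocalizedModule.map S T.mkQ) :=
    IsLocalizedModule.map_surjective S _ _ _ T.mkQ_surjective
  obtain ⟨σ, hσ⟩ := LinearMap.exists_rightInverse_of_surjective (LocalizedModule.map S T.mkQ)
    (LinearMap.range_eq_top.mpr hsurj)
  obtain ⟨ρ, hρ⟩ := (show (∃ l, LocalizedModule.map S T.mkQ ∘ₗ l = LinearMap.id) →
    ∃ l, l ∘ₗ LocalizedModule.map S T.subtype = LinearMap.id from
    ((hex.split_tfae hinj hsurj).out 0 1).mp) ⟨σ, hσ⟩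
  obtain ⟨f, s, hf⟩ := Module.FinitePresentation.exists_lift_of_isLocalizedModule S
    (LocalizedModule.mkLinearMap S T)
    ((ρ.restrictScalars A) ∘ₗ LocalizedModule.mkLinearMap S M)
  refine ⟨f, s, fun t => ?_⟩
  have h1 := LinearMap.congr_fun hf (t : M)
  have h2 : ρ (LocalizedModule.mkLinearMap S M t) = LocalizedModule.mkLinearMap S T t := by
    have := LinearMap.congr_fun hρ (LocalizedModule.mkLinearMap S T t)
    simpa using this
  have h3 : LocalizedModule.mkLinearMap S T (f t) = LocalizedModule.mkLinearMap S T (s • t) := by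
    rw [Submonoid.smul_def, map_smul, ← h2]
    exact h1
  exact (IsLocalizedModule.eq_iff_exists S (LocalizedModule.mkLinearMap S T)).mp h3

theorem stmt3 {A : Type u} [CommRing A] [IsSemisimpleRing (FractionRing A)]
    (M : Type u) [AddCommGroup M] [Module A M] [Module.FinitePresentation A M]
    (S : Submonoid A)
    (hS : (S : Set A) =
      (⋃ q ∈ {q : PrimeSpectrum A | Order.height q = 1 ∧
          q ∈ Module.support A (Submodule.torsion A M)}, (q.asIdeal : Set A))ᶜ)
    (hprod : ∃ (n : ℕ) (B : Fin n → Type u) (h : ∀ i, CommRing (B i)),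
      letI := h
      (∀ i, IsPruferDomain (B i)) ∧
        Nonempty (Localization S ≃+* ((i : Fin n) → B i))) :
    ∃ f : M →ₗ[A] (↥(Submodule.torsion A M) × (M ⧸ Submodule.torsion A M)),
      IsPseudoNull A (LinearMap.ker f) ∧
      IsPseudoNull A
        ((↥(Submodule.torsion A M) × (M ⧸ Submodule.torsion A M)) ⧸
          LinearMap.range f) := by
  classical
  obtain ⟨n, B, hring, hB, ⟨e⟩⟩ := hprod
  letI := hring
  have hproj := projective_of_prod B hB e (LocalizedModule S (M ⧸ Submodule.torsion A M))
    (fun c hc x hx => localized_torsionFree M S c hc x hx)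
  obtain ⟨f, s, hf⟩ := exists_almost_retraction M S hproj
  -- the key local statement
  have key : ∀ q : PrimeSpectrum A, Order.height q ≤ 1 → ∀ t : Submodule.torsion A M,
      (∃ r ∉ q.asIdeal, r • t = 0) ∨
        ∃ u v : A, u ∉ q.asIdeal ∧ v ∉ q.asIdeal ∧ u • f t = (u * v) • t := by
    intro q hq t
    by_cases hsupp : q ∈ Module.support A (Submodule.torsion A M)
    · right
      have hq1 : Order.height q = 1 := by
        refine le_antisymm hq (Order.one_le_iff_pos.mpr (pos_iff_ne_zero.mpr fun h0 => ?_))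
        have hmin := PrimeSpectrum.isMin_iff.mp (Order.height_eq_zero.mp h0)
        refine Module.notMem_support_iff'.mpr ?_ hsupp
        rintro ⟨m, r, hr⟩
        exact ⟨r, fun hrq => notMem_nonZeroDivisors_of_mem_mem_minimalPrimes hrq hmin r.2,
          Subtype.ext hr⟩
      have hSq : ∀ w : S, (w : A) ∉ q.asIdeal := by
        intro w hw
        have : (w : A) ∈ (S : Set A) := w.2
        rw [hS] at this
        exact this (Set.mem_biUnion (show q ∈ {q : PrimeSpectrum A | Order.height q = 1 ∧
          q ∈ Module.support A (Submodule.torsion A M)} from ⟨hq1, hsupp⟩) hw)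
      obtain ⟨u, hu⟩ := hf t
      refine ⟨u, s, hSq u, hSq s, ?_⟩
      rw [mul_smul]
      exact hu
    · left
      exact Module.notMem_support_iff'.mp hsupp t
  refine ⟨f.prod (Submodule.torsion A M).mkQ, ?_, ?_⟩
  · intro q hq
    rw [LocalizedModule.subsingleton_iff]
    rintro ⟨x, hx⟩
    have hx' : f x = 0 ∧ (Submodule.torsion A M).mkQ x = 0 := by simpa using hx
    have hxT : x ∈ Submodule.torsion A M := by simpa using hx'.2
    rcases key q hq ⟨x, hxT⟩ with ⟨r, hr, h⟩ | ⟨u, v, hu, hv, h⟩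
    · exact ⟨r, hr, Subtype.ext (show r • x = 0 from congrArg Subtype.val h)⟩
    · refine ⟨u * v, q.asIdeal.primeCompl.mul_mem hu hv, Subtype.ext ?_⟩
      rw [hx'.1, smul_zero] at h
      exact (congrArg Subtype.val h).symm
  · intro q hq
    rw [LocalizedModule.subsingleton_iff]
    intro z
    obtain ⟨⟨t, m⟩, rfl⟩ := Submodule.Quotient.mk_surjective _ z
    obtain ⟨m, rfl⟩ := Submodule.Quotient.mk_surjective _ m
    have : ∃ r ∉ q.asIdeal, ∃ t' : Submodule.torsion A M, f t' = r • (t - f m) := by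
      rcases key q hq (t - f m) with ⟨r, hr, h⟩ | ⟨u, v, hu, hv, h⟩
      · exact ⟨r, hr, 0, by rw [h]; simp⟩
      · exact ⟨u * v, q.asIdeal.primeCompl.mul_mem hu hv, u • (t - f m), by
          rw [← h, Submodule.coe_smul, map_smul]⟩
    obtain ⟨r, hr, t', ht'⟩ := this
    refine ⟨r, hr, ?_⟩
    rw [← Submodule.Quotient.mk_smul, Submodule.Quotient.mk_eq_zero]
    refine ⟨r • m + t', Prod.ext ?_ ?_⟩
    · change f (r • m + t') = r • t
      rw [map_add, map_smul, ht', smul_sub]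
      abel
    · have h0 : (Submodule.torsion A M).mkQ t' = 0 := by simp
      change (Submodule.torsion A M).mkQ (r • m + t') = r • (Submodule.torsion A M).mkQ m
      rw [map_add, map_smul, h0, add_zero]
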